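/- Let m ≥ 2 and let A be the adjacency matrix of the rose graph R_m^4 on 3m + 1 vertices. Define the vector μ by μ(0) = √(m/(2m+2)), μ(i) = 1/(2√m) for each internal node i, and μ(j) = 1/√(m(2m+2)) for each peripheral node j. Then μ has positive entries, unit Euclidean norm, and satisfies A μ = √(2m+2)·μ; moreover, √(2m+2) is the largest eigenvalue of A, i.e., every real eigenvalue λ of A satisfies λ ≤ √(2m+2). -/

import Mathlib

open Finset
/-- Adjacency matrix of the rose graph `R_m^4` on `3m+1` vertices: vertex `0` is the hub;
for each petal `p`, vertices `3p+1`, `3p+2` are internal and `3p+3` is peripheral, with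
edges `{0,3p+1}`, `{0,3p+2}`, `{3p+1,3p+3}`, `{3p+2,3p+3}`. -/
noncomputable def roseA (m : ℕ) : Matrix (Fin (3 * m + 1)) (Fin (3 * m + 1)) ℝ :=
  fun i j =>
    if ((i : ℕ) = 0 ∧ (j : ℕ) % 3 ≠ 0) ∨ ((j : ℕ) = 0 ∧ (i : ℕ) % 3 ≠ 0)
        ∨ ((i : ℕ) % 3 = 1 ∧ (j : ℕ) = (i : ℕ) + 2)
        ∨ ((i : ℕ) % 3 = 2 ∧ (j : ℕ) = (i : ℕ) + 1)
        ∨ ((j : ℕ) % 3 = 1 ∧ (i : ℕ) = (j : ℕ) + 2)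
        ∨ ((j : ℕ) % 3 = 2 ∧ (i : ℕ) = (j : ℕ) + 1)
    then 1 else 0

/-- A sum over the vertices of the rose graph is the hub term plus the sum over the petals. -/
theorem sum_range_three_mul_add_one (f : ℕ → ℝ) (m : ℕ) :
    ∑ i ∈ range (3 * m + 1), f i =
      f 0 + ∑ p ∈ range m, (f (3 * p + 1) + f (3 * p + 2) + f (3 * p + 3)) := by
  induction m with
  | zero => simp
  | succ k ih =>
    rw [show 3 * (k + 1) + 1 = 3 * k + 1 + 1 + 1 + 1 by ring, sum_range_succ, sum_range_succ,
      sum_range_succ, ih, sum_range_succ]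
    ring

/-- An eigenvalue of a symmetric nonnegative matrix is at most the eigenvalue of any positive
eigenvector. -/
theorem eigenvalue_le_of_pos_eigenvector {ι : Type*} [Fintype ι] {A : Matrix ι ι ℝ}
    (hsymm : A.IsSymm) (hA : ∀ i j, 0 ≤ A i j) {v : ι → ℝ} (hv : ∀ i, 0 < v i) {ρ : ℝ}
    (hAv : A.mulVec v = ρ • v) {lam : ℝ} {u : ι → ℝ} (hu : u ≠ 0)
    (hAu : A.mulVec u = lam • u) : lam ≤ ρ := by
  obtain ⟨k, hk⟩ := Function.ne_iff.mp hu
  have hpos : 0 < ∑ i, v i * |u i| :=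
    sum_pos' (fun i _ => mul_nonneg (hv i).le (abs_nonneg _))
      ⟨k, mem_univ k, mul_pos (hv k) (abs_pos.mpr hk)⟩
  have hrow (i : ι) : lam * |u i| ≤ ∑ j, A i j * |u j| := by
    have h : ∑ j, A i j * u j = lam * u i := congrFun hAu i
    calc lam * |u i| ≤ |lam| * |u i| := by gcongr; exact le_abs_self _
      _ = |∑ j, A i j * u j| := by rw [h, abs_mul]
      _ ≤ ∑ j, |A i j * u j| := abs_sum_le_sum_abs _ _
      _ = ∑ j, A i j * |u j| := by simp_rw [abs_mul, abs_of_nonneg (hA _ _)]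
  have hcol (j : ι) : ∑ i, v i * A i j = ρ * v j := by
    have h : ∑ i, A j i * v i = ρ * v j := congrFun hAv j
    rw [← h]
    exact sum_congr rfl fun i _ => by rw [hsymm.apply j i, mul_comm]
  refine le_of_mul_le_mul_right ?_ hpos
  calc lam * ∑ i, v i * |u i| = ∑ i, v i * (lam * |u i|) := by
        rw [mul_sum]; exact sum_congr rfl fun i _ => by ring
    _ ≤ ∑ i, v i * ∑ j, A i j * |u j| :=
        sum_le_sum fun i _ => mul_le_mul_of_nonneg_left (hrow i) (hv i).le
    _ = ∑ j, (∑ i, v i * A i j) * |u j| := by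
        simp_rw [mul_sum, sum_mul]
        rw [sum_comm]
        simp_rw [mul_assoc]
    _ = ρ * ∑ i, v i * |u i| := by simp_rw [hcol, mul_sum, mul_assoc]

theorem roseA_isSymm (m : ℕ) : (roseA m).IsSymm := by
  ext i j
  simp only [Matrix.transpose_apply, roseA]
  congr 1
  apply propext
  tauto

theorem roseA_nonneg (m : ℕ) (i j : Fin (3 * m + 1)) : 0 ≤ roseA m i j := by
  unfold roseA
  split_ifs <;> simp

theorem roseA_mulVec_eq_sum_filter (m : ℕ) (g : ℕ → ℝ) (i : Fin (3 * m + 1)) :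
    (roseA m).mulVec (fun j => g j) i =
      ∑ j ∈ range (3 * m + 1) with
        (((i : ℕ) = 0 ∧ j % 3 ≠ 0) ∨ (j = 0 ∧ (i : ℕ) % 3 ≠ 0)
        ∨ ((i : ℕ) % 3 = 1 ∧ j = (i : ℕ) + 2)
        ∨ ((i : ℕ) % 3 = 2 ∧ j = (i : ℕ) + 1)
        ∨ (j % 3 = 1 ∧ (i : ℕ) = j + 2)
        ∨ (j % 3 = 2 ∧ (i : ℕ) = j + 1)), g j := by
  rw [sum_filter, ← Fin.sum_univ_eq_sum_range]
  simp only [Matrix.mulVec, dotProduct, roseA, ite_mul, one_mul, zero_mul]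

theorem roseA_mulVec_hub (m : ℕ) (g : ℕ → ℝ) (i : Fin (3 * m + 1)) (hi : (i : ℕ) = 0) :
    (roseA m).mulVec (fun j => g j) i =
      ∑ p ∈ range m, (g (3 * p + 1) + g (3 * p + 2)) := by
  rw [roseA_mulVec_eq_sum_filter, filter_congr (q := fun j => j % 3 ≠ 0) fun j _ => by omega,
    sum_filter, sum_range_three_mul_add_one]
  simp [Nat.add_mod]

theorem roseA_mulVec_internal (m : ℕ) (g : ℕ → ℝ) (i : Fin (3 * m + 1))
    (hi : (i : ℕ) % 3 ≠ 0) :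
    (roseA m).mulVec (fun j => g j) i = g 0 + g (i + 3 - i % 3) := by
  rw [roseA_mulVec_eq_sum_filter, ← sum_pair (f := g) (a := 0) (b := i + 3 - i % 3) (by omega)]
  refine sum_congr ?_ fun _ _ => rfl
  ext j
  have := i.isLt
  simp only [mem_filter, mem_range, mem_insert, mem_singleton]
  omega

theorem roseA_mulVec_peripheral (m : ℕ) (g : ℕ → ℝ) (i : Fin (3 * m + 1))
    (h0 : (i : ℕ) ≠ 0) (hi : (i : ℕ) % 3 = 0) :
    (roseA m).mulVec (fun j => g j) i = g (i - 2) + g (i - 1) := by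
  rw [roseA_mulVec_eq_sum_filter, ← sum_pair (f := g) (a := i - 2) (b := i - 1) (by omega)]
  refine sum_congr ?_ fun _ _ => rfl
  ext j
  have := i.isLt
  simp only [mem_filter, mem_range, mem_insert, mem_singleton]
  omega

/-- The vector `μ` with `μ(hub) = √(m/(2m+2))`, `μ(internal) = 1/(2√m)` and
`μ(peripheral) = 1/√(m(2m+2))` is a positive unit eigenvector of the adjacency matrix of
the rose graph `R_m^4` with eigenvalue `√(2m+2)`, and `√(2m+2)` is the largest real
eigenvalue of the adjacency matrix. -/
theorem rose_adjacency_perron (m : ℕ) (hm : 2 ≤ m)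
    (μ : Fin (3 * m + 1) → ℝ)
    (hμ : ∀ i, μ i =
      if (i : ℕ) = 0 then Real.sqrt ((m : ℝ) / (2 * (m : ℝ) + 2))
      else if (i : ℕ) % 3 ≠ 0 then 1 / (2 * Real.sqrt (m : ℝ))
      else 1 / Real.sqrt ((m : ℝ) * (2 * (m : ℝ) + 2))) :
    (∀ i, 0 < μ i) ∧ (∑ i, μ i ^ 2) = 1 ∧
      (roseA m).mulVec μ = Real.sqrt (2 * (m : ℝ) + 2) • μ ∧
      ∀ (lam : ℝ) (u : Fin (3 * m + 1) → ℝ), u ≠ 0 →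
        (roseA m).mulVec u = lam • u → lam ≤ Real.sqrt (2 * (m : ℝ) + 2) := by
  have hm0 : (0 : ℝ) < m := by exact_mod_cast (by omega : 0 < m)
  have ht0 : (0 : ℝ) < 2 * (m : ℝ) + 2 := by positivity
  simp only [Real.sqrt_div hm0.le, Real.sqrt_mul hm0.le] at hμ
  set s := Real.sqrt (m : ℝ)
  set t := Real.sqrt (2 * (m : ℝ) + 2)
  have hs_pos : 0 < s := Real.sqrt_pos.mpr hm0
  have ht_pos : 0 < t := Real.sqrt_pos.mpr ht0
  have hs_sq : s ^ 2 = m := Real.sq_sqrt hm0.le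
  have ht_sq : t ^ 2 = 2 * s ^ 2 + 2 := by rw [hs_sq]; exact Real.sq_sqrt ht0.le
  let g : ℕ → ℝ := fun n =>
    if n = 0 then s / t else if n % 3 ≠ 0 then 1 / (2 * s) else 1 / (s * t)
  have hg_hub : g 0 = s / t := rfl
  have hg_internal (n : ℕ) (hn : n % 3 ≠ 0) : g n = 1 / (2 * s) := by
    have : n ≠ 0 := by rintro rfl; exact hn rfl
    simp only [g, if_neg this, if_pos hn]
  have hg_peripheral (n : ℕ) (h0 : n ≠ 0) (hn : n % 3 = 0) : g n = 1 / (s * t) := by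
    simp [g, h0, hn]
  obtain rfl : μ = fun i : Fin (3 * m + 1) => g i := funext hμ
  have hpos (i : Fin (3 * m + 1)) : 0 < g i := by
    simp only [g]
    split_ifs <;> positivity
  have heig : (roseA m).mulVec (fun i => g i) = t • fun i : Fin (3 * m + 1) => g i := by
    ext i
    rw [Pi.smul_apply, smul_eq_mul]
    by_cases h0 : (i : ℕ) = 0
    · rw [roseA_mulVec_hub m g i h0, h0, hg_hub, sum_congr rfl fun p _ => by
        rw [hg_internal (3 * p + 1) (by omega), hg_internal (3 * p + 2) (by omega)]]
      rw [sum_const, card_range, nsmul_eq_mul, ← hs_sq]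
      field_simp
      ring
    by_cases hi : (i : ℕ) % 3 = 0
    · rw [roseA_mulVec_peripheral m g i h0 hi, hg_peripheral i h0 hi,
        hg_internal _ (by omega), hg_internal _ (by omega)]
      field_simp
      ring
    · rw [roseA_mulVec_internal m g i hi, hg_hub, hg_internal i hi,
        hg_peripheral _ (by omega) (by omega)]
      field_simp
      linear_combination -ht_sq
  refine ⟨hpos, ?_, heig, fun lam u hu h =>
    eigenvalue_le_of_pos_eigenvector (roseA_isSymm m) (roseA_nonneg m) hpos heig hu h⟩
  rw [Fin.sum_univ_eq_sum_range (fun n => g n ^ 2), sum_range_three_mul_add_one, hg_hub,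
    sum_congr rfl fun p _ => by
      rw [hg_internal (3 * p + 1) (by omega), hg_internal (3 * p + 2) (by omega),
        hg_peripheral (3 * p + 3) (by omega) (by omega)]]
  rw [sum_const, card_range, nsmul_eq_mul, ← hs_sq]
  field_simp
  linear_combination -2 * ht_sq
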